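/- For every ρ > 0 and T > 0 there exists a constant C_{ρ,T} > 0 such that for any two global mild solutions u¹ and u² with initial data φ¹, φ² ∈ W satisfying |φ¹|_W ≤ ρ and |φ²|_W ≤ ρ, one has √⟨A(u¹(t)−u²(t)), u¹(t)−u²(t)⟩ + ‖u̇¹(t) − u̇²(t)‖ ≤ C_{ρ,T} |φ¹ − φ²|_W for all t ∈ [0,T]. -/

import Mathlib

open Set Real MeasureTheory
open scoped RealInnerProductSpace

noncomputable section

/-- Euclidean space `ℝⁿ`. -/
abbrev Euc (n : ℕ) := EuclideanSpace ℝ (Fin n)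

/-- `(φ, φ')` is a `C¹` pair on `[-h,0]`: `φ'` is the (one-sided) derivative of `φ` on
`[-h,0]` and is continuous there. -/
def IsC1Pair (n : ℕ) (h : ℝ) (φ φ' : ℝ → Euc n) : Prop :=
  (∀ θ ∈ Icc (-h) (0:ℝ), HasDerivWithinAt φ (φ' θ) (Icc (-h) 0) θ) ∧
    ContinuousOn φ' (Icc (-h) 0)

/-- The norm of `W = C¹([-h,0];ℝⁿ)`:
`|φ|_W = max_{θ∈[-h,0]} ‖φ(θ)‖ + max_{θ∈[-h,0]} ‖φ'(θ)‖`. -/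
def Wnorm (n : ℕ) (h : ℝ) (φ φ' : ℝ → Euc n) : ℝ :=
  (⨆ θ : Icc (-h) (0:ℝ), ‖φ θ.1‖) + ⨆ θ : Icc (-h) (0:ℝ), ‖φ' θ.1‖

/-- A mild solution of `ü + k u̇ + A u + F(u) + M(u_t) = 0` on `[0,T)` with initial
datum `(φ, φ')`: `u` is `C¹` on `[-h,T)` with derivative `u'`, coincides with `φ` on
`[-h,0]`, and `u̇(t) = φ'(0) - ∫₀ᵗ (k u̇(s) + A u(s) + F(u(s)) + M(u_s)) ds` on `[0,T)`.
Here `M` takes the segment `u_s` as a pair (the function and its derivative). -/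
def IsMildSolOn (n : ℕ) (h k T : ℝ) (A : Euc n →L[ℝ] Euc n) (F : Euc n → Euc n)
    (M : (ℝ → Euc n) → (ℝ → Euc n) → Euc n) (φ φ' u u' : ℝ → Euc n) : Prop :=
  (∀ t ∈ Ico (-h) T, HasDerivWithinAt u (u' t) (Ico (-h) T) t) ∧
  ContinuousOn u' (Ico (-h) T) ∧
  (∀ θ ∈ Icc (-h) (0:ℝ), u θ = φ θ ∧ u' θ = φ' θ) ∧
  (∀ t ∈ Ico (0:ℝ) T, u' t = φ' 0 - ∫ s in (0:ℝ)..t,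
      (k • u' s + A (u s) + F (u s) + M (fun θ => u (s + θ)) (fun θ => u' (s + θ))))

/-- A global mild solution (on `[0,∞)`). -/
def IsGlobalMildSol (n : ℕ) (h k : ℝ) (A : Euc n →L[ℝ] Euc n) (F : Euc n → Euc n)
    (M : (ℝ → Euc n) → (ℝ → Euc n) → Euc n) (φ φ' u u' : ℝ → Euc n) : Prop :=
  (∀ t ∈ Ici (-h), HasDerivWithinAt u (u' t) (Ici (-h)) t) ∧
  ContinuousOn u' (Ici (-h)) ∧
  (∀ θ ∈ Icc (-h) (0:ℝ), u θ = φ θ ∧ u' θ = φ' θ) ∧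
  (∀ t ∈ Ici (0:ℝ), u' t = φ' 0 - ∫ s in (0:ℝ)..t,
      (k • u' s + A (u s) + F (u s) + M (fun θ => u (s + θ)) (fun θ => u' (s + θ))))

/-- Hypothesis (M1): local Lipschitz property of the delay term in the `W`-norm. -/
def HypM1 (n : ℕ) (h : ℝ) (M : (ℝ → Euc n) → (ℝ → Euc n) → Euc n) : Prop :=
  ∀ ρ > (0:ℝ), ∃ C > (0:ℝ), ∀ φ₁ φ₁' φ₂ φ₂' : ℝ → Euc n,
    IsC1Pair n h φ₁ φ₁' → IsC1Pair n h φ₂ φ₂' →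
    Wnorm n h φ₁ φ₁' ≤ ρ → Wnorm n h φ₂ φ₂' ≤ ρ →
    ‖M φ₁ φ₁' - M φ₂ φ₂'‖ ≤ C * Wnorm n h (φ₁ - φ₂) (φ₁' - φ₂')

open Filter Topology

/-- If every bound of `f` by a multiple of `exp (c s)` on `[0,t]` improves to half of that multiple
plus a constant, then `f` grows at most like `exp (c s)`. -/
lemma le_two_mul_exp_of_improving_bound {f : ℝ → ℝ} {a c T : ℝ} (hf : ContinuousOn f (Icc 0 T))
    (ha : 0 ≤ a) (hc : 0 ≤ c)
    (H : ∀ m ≥ 0, ∀ t ∈ Icc 0 T, (∀ s ∈ Icc 0 t, f s ≤ m * exp (c * s)) →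
      f t ≤ a + m / 2 * exp (c * t)) :
    ∀ t ∈ Icc 0 T, f t ≤ 2 * a * exp (c * t) := by
  intro t ht
  obtain ⟨t₀, ht₀, hmax⟩ := isCompact_Icc.exists_isMaxOn (⟨t, ht⟩ : (Icc 0 T).Nonempty)
    (f := fun s => f s * exp (-(c * s))) (hf.mul (by fun_prop))
  set m := max (f t₀ * exp (-(c * t₀))) 0 with hm
  have hcancel (x s : ℝ) : x * exp (-(c * s)) * exp (c * s) = x := by
    rw [mul_assoc, ← exp_add]; simp
  have hfm : ∀ s ∈ Icc 0 T, f s ≤ m * exp (c * s) := by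
    intro s hs
    rw [← hcancel (f s) s]
    gcongr
    exact (hmax hs).trans (le_max_left _ _)
  have h₀ := H m (le_max_right _ _) t₀ ht₀ fun s hs => hfm s ⟨hs.1, hs.2.trans ht₀.2⟩
  have h₁ : f t₀ * exp (-(c * t₀)) ≤ a + m / 2 := by
    have he : exp (-(c * t₀)) ≤ 1 := by
      rw [exp_le_one_iff]; linarith [mul_nonneg hc ht₀.1]
    calc f t₀ * exp (-(c * t₀)) ≤ (a + m / 2 * exp (c * t₀)) * exp (-(c * t₀)) := by gcongr
      _ = a * exp (-(c * t₀)) + m / 2 * (exp (c * t₀) * exp (-(c * t₀))) := by ring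
      _ = a * exp (-(c * t₀)) + m / 2 := by rw [← exp_add]; simp
      _ ≤ a + m / 2 := by linarith [mul_le_mul_of_nonneg_left he ha]
  have h₂ : m ≤ a + m / 2 := max_le h₁ (by linarith [le_max_right (f t₀ * exp (-(c * t₀))) 0])
  calc f t ≤ m * exp (c * t) := hfm t ht
    _ ≤ 2 * a * exp (c * t) := by gcongr; linarith

/-- Gronwall inequality with memory: the right derivative of `f` is controlled affinely by the
supremum of `f` over the past. -/
lemma gronwall_memory {f f' : ℝ → ℝ} {a b c T : ℝ} (hf : ContinuousOn f (Icc 0 T))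
    (hf' : ∀ t ∈ Ico 0 T, HasDerivWithinAt f (f' t) (Ici t) t) (hfa : f 0 ≤ a)
    (ha : 0 ≤ a) (hb : 0 ≤ b) (hc : 0 ≤ c) (hT : 0 ≤ T)
    (H : ∀ N ≥ 0, ∀ t ∈ Ico 0 T, (∀ s ∈ Icc 0 t, f s ≤ N) → f' t ≤ c + b * N) :
    ∀ t ∈ Icc 0 T, f t ≤ 2 * (a + c * T) * exp (2 * b * t) := by
  refine le_two_mul_exp_of_improving_bound hf (by positivity) (by positivity) ?_
  intro m hm t ht hs
  have hB (x : ℝ) : HasDerivAt (fun x => a + c * x + m / 2 * exp (2 * b * x))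
      (c + b * (m * exp (2 * b * x))) x := by
    have h₁ := ((hasDerivAt_id x).const_mul (2 * b)).exp.const_mul (m / 2)
    have h₂ := (((hasDerivAt_id x).const_mul c).const_add a).add h₁
    refine h₂.congr_deriv ?_
    simp only [id]; ring
  have hle := image_le_of_deriv_right_le_deriv_boundary (a := 0) (b := t)
    (hf.mono (Icc_subset_Icc_right ht.2)) (fun x hx => hf' x ⟨hx.1, hx.2.trans_le ht.2⟩)
    (B := fun x => a + c * x + m / 2 * exp (2 * b * x)) (by simp; linarith)
    (fun x _ => (hB x).continuousAt.continuousWithinAt) (fun x _ => (hB x).hasDerivWithinAt)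
    (fun x hx => H _ (by positivity) x ⟨hx.1, hx.2.trans_le ht.2⟩ fun s hsx =>
      (hs s ⟨hsx.1, hsx.2.trans hx.2.le⟩).trans (by gcongr; exact hsx.2)) ⟨ht.1, le_rfl⟩
  have := mul_le_mul_of_nonneg_left ht.2 hc
  linarith

/-- Gronwall inequality with memory for the norm of a vector-valued function. -/
lemma gronwall_memory_norm {E : Type*} [NormedAddCommGroup E] [NormedSpace ℝ E] {y y' : ℝ → E}
    {a b c T : ℝ} (hy : ContinuousOn y (Icc 0 T))
    (hy' : ∀ t ∈ Ico 0 T, HasDerivWithinAt y (y' t) (Ici t) t) (hya : ‖y 0‖ ≤ a)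
    (hb : 0 ≤ b) (hc : 0 ≤ c) (hT : 0 ≤ T)
    (H : ∀ N ≥ 0, ∀ t ∈ Ico 0 T, (∀ s ∈ Icc 0 t, ‖y s‖ ≤ N) → ‖y' t‖ ≤ c + b * N) :
    ∀ t ∈ Icc 0 T, ‖y t‖ ≤ 2 * (a + c * T) * exp (2 * b * t) := by
  have ha : 0 ≤ a := (norm_nonneg _).trans hya
  refine le_two_mul_exp_of_improving_bound hy.norm (by positivity) (by positivity) ?_
  intro m hm t ht hs
  have hB (x : ℝ) : HasDerivAt (fun x => a + c * x + m / 2 * exp (2 * b * x))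
      (c + b * (m * exp (2 * b * x))) x := by
    have h₁ := ((hasDerivAt_id x).const_mul (2 * b)).exp.const_mul (m / 2)
    have h₂ := (((hasDerivAt_id x).const_mul c).const_add a).add h₁
    refine h₂.congr_deriv ?_
    simp only [id]; ring
  have hle := image_norm_le_of_norm_deriv_right_le_deriv_boundary (a := 0) (b := t)
    (hy.mono (Icc_subset_Icc_right ht.2)) (fun x hx => hy' x ⟨hx.1, hx.2.trans_le ht.2⟩)
    (B := fun x => a + c * x + m / 2 * exp (2 * b * x)) (by simp; linarith) hB
    (fun x hx => H _ (by positivity) x ⟨hx.1, hx.2.trans_le ht.2⟩ fun s hsx =>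
      (hs s ⟨hsx.1, hsx.2.trans hx.2.le⟩).trans (by gcongr; exact hsx.2)) ⟨ht.1, le_rfl⟩
  have := mul_le_mul_of_nonneg_left ht.2 hc
  linarith

lemma Wnorm_le {n : ℕ} {h : ℝ} (hh : 0 ≤ h) {φ φ' : ℝ → Euc n} {a b : ℝ}
    (ha : ∀ θ ∈ Icc (-h) 0, ‖φ θ‖ ≤ a) (hb : ∀ θ ∈ Icc (-h) 0, ‖φ' θ‖ ≤ b) :
    Wnorm n h φ φ' ≤ a + b := by
  have : Nonempty (Icc (-h) (0 : ℝ)) := ⟨⟨0, by simpa using hh⟩⟩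
  exact add_le_add (ciSup_le fun θ => ha θ.1 θ.2) (ciSup_le fun θ => hb θ.1 θ.2)

namespace IsC1Pair

variable {n : ℕ} {h : ℝ} {φ φ' : ℝ → Euc n}

lemma continuousOn (hφ : IsC1Pair n h φ φ') : ContinuousOn φ (Icc (-h) 0) :=
  fun θ hθ => (hφ.1 θ hθ).continuousWithinAt

lemma norm_le_Wnorm (hφ : IsC1Pair n h φ φ') {θ : ℝ} (hθ : θ ∈ Icc (-h) 0) :
    ‖φ θ‖ ≤ Wnorm n h φ φ' ∧ ‖φ' θ‖ ≤ Wnorm n h φ φ' := by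
  have key {f : ℝ → Euc n} (hf : ContinuousOn f (Icc (-h) 0)) :
      ‖f θ‖ ≤ ⨆ θ : Icc (-h) (0 : ℝ), ‖f θ.1‖ := by
    obtain ⟨C, hC⟩ := isCompact_Icc.exists_bound_of_continuousOn hf
    exact le_ciSup (f := fun θ : Icc (-h) (0 : ℝ) => ‖f θ.1‖)
      ⟨C, by rintro _ ⟨θ, rfl⟩; exact hC θ.1 θ.2⟩ ⟨θ, hθ⟩
  have h₁ := key hφ.continuousOn
  have h₂ := key hφ.2
  unfold Wnorm
  constructor <;> linarith [norm_nonneg (φ θ), norm_nonneg (φ' θ)]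

lemma sub {ψ ψ' : ℝ → Euc n} (hφ : IsC1Pair n h φ φ') (hψ : IsC1Pair n h ψ ψ') :
    IsC1Pair n h (φ - ψ) (φ' - ψ') :=
  ⟨fun θ hθ => (hφ.1 θ hθ).sub (hψ.1 θ hθ), hφ.2.sub hψ.2⟩

lemma segment {u u' : ℝ → Euc n} (hu : ∀ t ∈ Ici (-h), HasDerivWithinAt u (u' t) (Ici (-h)) t)
    (hu' : ContinuousOn u' (Ici (-h))) {s : ℝ} (hs : 0 ≤ s) :
    IsC1Pair n h (fun θ => u (s + θ)) (fun θ => u' (s + θ)) := by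
  have hmaps : MapsTo (fun θ => s + θ) (Icc (-h) 0) (Ici (-h)) := fun θ hθ => by
    simp only [mem_Ici]; linarith [hθ.1]
  refine ⟨fun θ hθ => ?_, hu'.comp (by fun_prop) hmaps⟩
  have h₁ : HasDerivWithinAt (fun θ => s + θ) 1 (Icc (-h) 0) θ :=
    ((hasDerivAt_id θ).const_add s).hasDerivWithinAt
  exact ((hu (s + θ) (hmaps hθ)).scomp θ h₁ hmaps).congr_deriv (one_smul ℝ _)

end IsC1Pair

lemma eventually_segment_close {E : Type*} [NormedAddCommGroup E] {h : ℝ} {f : ℝ → E}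
    (hf : ContinuousOn f (Ici (-h))) {s₀ ε : ℝ} (hε : 0 < ε) :
    ∀ᶠ s in 𝓝[Ici 0] s₀, ∀ θ ∈ Icc (-h) 0, s₀ ∈ Ici 0 → ‖f (s + θ) - f (s₀ + θ)‖ ≤ ε := by
  have huc := isCompact_Icc.uniformContinuousOn_of_continuous
    (hf.mono (Icc_subset_Ici_self : Icc (-h) (s₀ + 1) ⊆ Ici (-h)))
  obtain ⟨δ, hδ, H⟩ := Metric.uniformContinuousOn_iff.1 huc ε hε
  filter_upwards [self_mem_nhdsWithin,
    mem_nhdsWithin_of_mem_nhds (Metric.ball_mem_nhds s₀ (lt_min hδ one_pos))] with s hs hsb θ hθ hs₀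
  rw [Metric.mem_ball, lt_min_iff] at hsb
  have hs1 := (abs_lt.1 (Real.dist_eq s s₀ ▸ hsb.2)).2
  simp only [mem_Ici] at hs hs₀
  rw [← dist_eq_norm]
  refine (H _ ⟨?_, ?_⟩ _ ⟨?_, ?_⟩ ?_).le
  · linarith [hθ.1]
  · linarith [hθ.2]
  · linarith [hθ.1]
  · linarith [hθ.2]
  · simpa using hsb.1

lemma HypM1.continuousOn_segment {n : ℕ} {h : ℝ} (hh : 0 ≤ h)
    {M : (ℝ → Euc n) → (ℝ → Euc n) → Euc n} (hM : HypM1 n h M) {u u' : ℝ → Euc n}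
    (hu : ∀ t ∈ Ici (-h), HasDerivWithinAt u (u' t) (Ici (-h)) t)
    (hu' : ContinuousOn u' (Ici (-h))) :
    ContinuousOn (fun s => M (fun θ => u (s + θ)) (fun θ => u' (s + θ))) (Ici 0) := by
  have hcu : ContinuousOn u (Ici (-h)) := fun t ht => (hu t ht).continuousWithinAt
  intro s₀ hs₀
  have hseg₀ := IsC1Pair.segment hu hu' hs₀
  obtain ⟨C, hC, hMC⟩ := hM (2 * (Wnorm n h (fun θ => u (s₀ + θ)) (fun θ => u' (s₀ + θ)) + 1)) (by
    have := (norm_nonneg _).trans (hseg₀.norm_le_Wnorm (θ := 0) (by simpa using hh)).1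
    positivity)
  refine Metric.tendsto_nhds.2 fun ε hε => ?_
  have hη : 0 < min (ε / (4 * C)) 1 := by positivity
  filter_upwards [eventually_segment_close (s₀ := s₀) hcu hη,
    eventually_segment_close (s₀ := s₀) hu' hη, self_mem_nhdsWithin] with s h₁ h₂ hs
  have hbd {f : ℝ → Euc n} {b : ℝ} {θ : ℝ} (hb : ‖f (s₀ + θ)‖ ≤ b)
      (hd : ‖f (s + θ) - f (s₀ + θ)‖ ≤ min (ε / (4 * C)) 1) : ‖f (s + θ)‖ ≤ b + 1 := by
    have := norm_add_le (f (s + θ) - f (s₀ + θ)) (f (s₀ + θ))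
    rw [sub_add_cancel] at this
    linarith [min_le_right (ε / (4 * C)) 1]
  have hW := hMC _ _ _ _ (IsC1Pair.segment hu hu' hs) hseg₀
    ((Wnorm_le hh (fun θ hθ => hbd (hseg₀.norm_le_Wnorm hθ).1 (h₁ θ hθ hs₀))
      (fun θ hθ => hbd (hseg₀.norm_le_Wnorm hθ).2 (h₂ θ hθ hs₀))).trans_eq (by ring))
    (by
      have := (norm_nonneg _).trans (hseg₀.norm_le_Wnorm (θ := 0) (by simpa using hh)).1
      linarith)
  have hD := Wnorm_le hh (φ := (fun θ => u (s + θ)) - fun θ => u (s₀ + θ))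
    (φ' := (fun θ => u' (s + θ)) - fun θ => u' (s₀ + θ)) (fun θ hθ => h₁ θ hθ hs₀)
    (fun θ hθ => h₂ θ hθ hs₀)
  rw [dist_eq_norm]
  calc _ ≤ C * (ε / (4 * C) + ε / (4 * C)) := hW.trans (mul_le_mul_of_nonneg_left
        (hD.trans (add_le_add (min_le_left _ _) (min_le_left _ _))) hC.le)
    _ = ε / 2 := by field_simp; ring
    _ < ε := by linarith

namespace IsGlobalMildSol

variable {n : ℕ} {h k : ℝ} {A : Euc n →L[ℝ] Euc n} {F : Euc n → Euc n}
  {M : (ℝ → Euc n) → (ℝ → Euc n) → Euc n} {φ φ' u u' : ℝ → Euc n}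

lemma continuousOn (hsol : IsGlobalMildSol n h k A F M φ φ' u u') : ContinuousOn u (Ici (-h)) :=
  fun t ht => (hsol.1 t ht).continuousWithinAt

lemma hasDerivWithinAt (hh : 0 ≤ h) (hsol : IsGlobalMildSol n h k A F M φ φ' u u') {t : ℝ}
    (ht : 0 ≤ t) : HasDerivWithinAt u (u' t) (Ici t) t :=
  (hsol.1 t (by simp only [mem_Ici]; linarith)).mono (Ici_subset_Ici.2 (by linarith))

/-- A mild solution satisfies the equation in the classical sense. -/
lemma hasDerivWithinAt_deriv (hh : 0 ≤ h) (hF : Continuous F) (hM : HypM1 n h M)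
    (hsol : IsGlobalMildSol n h k A F M φ φ' u u') {t : ℝ} (ht : 0 ≤ t) :
    HasDerivWithinAt u' (-(k • u' t + A (u t) + F (u t) +
      M (fun θ => u (t + θ)) (fun θ => u' (t + θ)))) (Ici t) t := by
  set G : ℝ → Euc n := fun s => k • u' s + A (u s) + F (u s) +
    M (fun θ => u (s + θ)) (fun θ => u' (s + θ)) with hG
  have hsub : Ici (0 : ℝ) ⊆ Ici (-h) := Ici_subset_Ici.2 (by linarith)
  have hGc : ContinuousOn G (Ici 0) :=
    ((((hsol.2.1.mono hsub).const_smul k).add (A.continuous.comp_continuousOn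
      (hsol.continuousOn.mono hsub))).add (hF.comp_continuousOn
      (hsol.continuousOn.mono hsub))).add (hM.continuousOn_segment hh hsol.1 hsol.2.1)
  have hGc' : Continuous fun s => G (max s 0) :=
    hGc.comp_continuous (by fun_prop) fun s => le_max_right s 0
  have hint {s : ℝ} (hs : 0 ≤ s) : u' s = φ' 0 - ∫ r in (0 : ℝ)..s, G (max r 0) := by
    rw [hsol.2.2.2 s hs]
    congr 1
    refine intervalIntegral.integral_congr fun r hr => ?_
    rw [uIcc_of_le hs] at hr
    simp only [hG, max_eq_left hr.1]
  have hd := ((hGc'.integral_hasStrictDerivAt 0 t).hasDerivAt.const_sub (φ' 0)).hasDerivWithinAt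
    (s := Ici t)
  simp only [max_eq_left ht] at hd
  exact hd.congr (fun s hs => hint (ht.trans hs)) (hint ht)

/-- A bound for `u` and `u'` on `[0,t]` and for the initial datum bounds the whole history. -/
lemma norm_le_history (hφ : IsC1Pair n h φ φ') (hsol : IsGlobalMildSol n h k A F M φ φ' u u')
    {ρ N t : ℝ} (hρ : Wnorm n h φ φ' ≤ ρ) (hρ0 : 0 ≤ ρ) (hN : 0 ≤ N)
    (H : ∀ s ∈ Icc 0 t, ‖u s‖ ≤ N ∧ ‖u' s‖ ≤ N) :
    ∀ s ∈ Icc (-h) t, ‖u s‖ ≤ N + ρ ∧ ‖u' s‖ ≤ N + ρ := by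
  intro s hs
  rcases le_total 0 s with h0 | h0
  · have := H s ⟨h0, hs.2⟩
    constructor <;> linarith
  · have hs' : s ∈ Icc (-h) 0 := ⟨hs.1, h0⟩
    rw [(hsol.2.2.1 s hs').1, (hsol.2.2.1 s hs').2]
    have := hφ.norm_le_Wnorm hs'
    constructor <;> linarith

end IsGlobalMildSol

lemma sqrt_inner_self_le {n : ℕ} (A : Euc n →L[ℝ] Euc n) (x : Euc n) :
    √⟪A x, x⟫ ≤ √‖A‖ * ‖x‖ := by
  rw [← Real.sqrt_sq (norm_nonneg x), ← Real.sqrt_mul (norm_nonneg A)]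
  refine Real.sqrt_le_sqrt ((real_inner_le_norm _ _).trans ?_)
  nlinarith [A.le_opNorm x, norm_nonneg x]

set_option maxHeartbeats 800000 in
/-- Energy estimate: solutions starting in a ball of `W` stay bounded on `[-h,T]`. -/
lemma exists_apriori_bound
    {n : ℕ} {h k : ℝ} (hh : 0 < h) (hk : 0 < k) {A : Euc n →L[ℝ] Euc n}
    (hA_symm : ∀ x y : Euc n, ⟪A x, y⟫ = ⟪x, A y⟫)
    {F : Euc n → Euc n} (hF : Continuous F)
    {M : (ℝ → Euc n) → (ℝ → Euc n) → Euc n} (hM1 : HypM1 n h M)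
    {Pot Pot0 Pot1 : Euc n → ℝ} {Fstar : Euc n → Euc n} (hPot : Continuous Pot)
    (hF_grad : ∀ x : Euc n, HasGradientAt Pot (F x - Fstar x) x)
    {L : NNReal} (hFstar_lip : LipschitzWith L Fstar)
    (hPot_split : ∀ x, Pot x = Pot0 x + Pot1 x)
    (hPot0_nonneg : ∀ x, 0 ≤ Pot0 x)
    {C₁ : ℝ} (hC₁ : 0 < C₁) (hPot1_bound : ∀ x : Euc n,
      |Pot1 x| ≤ 1 / 2 * (⟪A x, x⟫ + Pot0 x) + C₁)
    {M₀ M₁ : ℝ} (hM₀ : 0 ≤ M₀) (hM₁ : 0 ≤ M₁)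
    (hM2 : ∀ φ φ' : ℝ → Euc n, IsC1Pair n h φ φ' →
      ‖M φ φ'‖ ≤ M₀ + M₁ * ((⨆ θ : Icc (-h) (0:ℝ), Real.sqrt ⟪A (φ θ.1), φ θ.1⟫) +
        ⨆ θ : Icc (-h) (0:ℝ), ‖φ' θ.1‖))
    {ρ T : ℝ} (hρ : 0 < ρ) (hT : 0 ≤ T) :
    ∃ R > (0 : ℝ), ∀ φ φ' u u' : ℝ → Euc n, IsC1Pair n h φ φ' → Wnorm n h φ φ' ≤ ρ →
      IsGlobalMildSol n h k A F M φ φ' u u' → ∀ t ∈ Icc (-h) T, ‖u t‖ ≤ R ∧ ‖u' t‖ ≤ R := by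
  obtain ⟨P₀, hP₀⟩ := (isCompact_closedBall (0 : Euc n) ρ).exists_bound_of_continuousOn
    hPot.continuousOn
  have hP₀0 : 0 ≤ P₀ := (norm_nonneg _).trans (hP₀ 0 (by simpa using hρ.le))
  set a : ℝ := ρ ^ 2 / 2 + ‖A‖ * ρ ^ 2 / 2 + P₀ + ρ ^ 2 / 2 + C₁ with ha_def
  set K₀ : ℝ := M₀ + ‖Fstar 0‖ with hK₀_def
  set K₁ : ℝ := M₁ * (√‖A‖ + 1) + L + 1 with hK₁_def
  set c : ℝ := 2 * (K₀ + K₁) * ρ ^ 2 + K₀ with hc_def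
  set b : ℝ := 4 * (K₀ + K₁) with hb_def
  have ha : 0 ≤ a := by positivity
  have hK₀ : 0 ≤ K₀ := by positivity
  have hK₁ : 0 ≤ K₁ := by positivity
  have hc : 0 ≤ c := by positivity
  have hb : 0 ≤ b := by positivity
  refine ⟨√(2 * (2 * (a + c * T) * exp (2 * b * T))) + ρ, by positivity, ?_⟩
  intro φ φ' u u' hφ hφρ hsol
  set V : ℝ → ℝ := fun t => ‖u' t‖ ^ 2 / 2 + ⟪A (u t), u t⟫ / 2 + Pot (u t) + ‖u t‖ ^ 2 / 2 + C₁
    with hV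
  have hV_lower (t : ℝ) : ‖u' t‖ ^ 2 / 2 + ‖u t‖ ^ 2 / 2 ≤ V t := by
    have h₁ := (abs_le.1 (hPot1_bound (u t))).1
    simp only [hV, hPot_split]
    linarith [hPot0_nonneg (u t)]
  have hbound {t N : ℝ} (hN : V t ≤ N) : ‖u t‖ ≤ √(2 * N) ∧ ‖u' t‖ ≤ √(2 * N) := by
    have h₁ := hV_lower t
    constructor <;> apply Real.le_sqrt_of_sq_le <;>
      linarith [sq_nonneg ‖u t‖, sq_nonneg ‖u' t‖]
  have hsub : Icc 0 T ⊆ Ici (-h) := fun t ht => by simp only [mem_Ici]; linarith [ht.1]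
  have hVc : ContinuousOn V (Icc 0 T) := by
    have h₁ := hsol.continuousOn.mono hsub
    have h₂ := hsol.2.1.mono hsub
    exact (((((h₂.norm.pow 2).div_const 2).add (((A.continuous.comp_continuousOn h₁).inner
      h₁).div_const 2)).add (hPot.comp_continuousOn h₁)).add ((h₁.norm.pow 2).div_const 2)).add
      continuousOn_const
  have hV0 : V 0 ≤ a := by
    have h0 : (0 : ℝ) ∈ Icc (-h) 0 := by simpa using hh.le
    have hu0 : ‖u 0‖ ≤ ρ := by
      rw [(hsol.2.2.1 0 h0).1]; exact (hφ.norm_le_Wnorm h0).1.trans hφρ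
    have hu0' : ‖u' 0‖ ≤ ρ := by
      rw [(hsol.2.2.1 0 h0).2]; exact (hφ.norm_le_Wnorm h0).2.trans hφρ
    have hA0 : ⟪A (u 0), u 0⟫ ≤ ‖A‖ * ρ ^ 2 :=
      calc _ ≤ ‖A (u 0)‖ * ‖u 0‖ := real_inner_le_norm _ _
        _ ≤ (‖A‖ * ρ) * ρ := by gcongr; exact A.le_opNorm_of_le hu0
        _ = ‖A‖ * ρ ^ 2 := by ring
    have hP := (le_abs_self _).trans (hP₀ (u 0) (by simpa using hu0))
    have h₁ : ‖u 0‖ ^ 2 ≤ ρ ^ 2 := by gcongr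
    have h₂ : ‖u' 0‖ ^ 2 ≤ ρ ^ 2 := by gcongr
    simp only [hV, ha_def]
    linarith
  set W : ℝ → Euc n := fun t => M (fun θ => u (t + θ)) (fun θ => u' (t + θ)) with hW
  set V' : ℝ → ℝ := fun t =>
    -k * ‖u' t‖ ^ 2 - ⟪W t, u' t⟫ - ⟪Fstar (u t), u' t⟫ + ⟪u t, u' t⟫ with hV'
  have hVd : ∀ t ∈ Ico 0 T, HasDerivWithinAt V (V' t) (Ici t) t := by
    intro t ht
    have d₁ := hsol.hasDerivWithinAt hh.le ht.1
    have d₂ := hsol.hasDerivWithinAt_deriv hh.le hF hM1 ht.1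
    have dA := A.hasFDerivAt.comp_hasDerivWithinAt t d₁
    have dP := (hF_grad (u t)).hasFDerivAt.comp_hasDerivWithinAt t d₁
    have := ((((d₂.norm_sq.div_const 2).add ((dA.inner ℝ d₁).div_const 2)).add dP).add
      (d₁.norm_sq.div_const 2)).add_const C₁
    refine this.congr_deriv ?_
    have e : ⟪A (u' t), u t⟫ = ⟪A (u t), u' t⟫ := by rw [hA_symm, real_inner_comm]
    simp only [Function.comp_apply, InnerProductSpace.toDual_apply_apply, inner_neg_right,
      inner_add_right, inner_sub_left, real_inner_smul_right, real_inner_self_eq_norm_sq, hV', hW,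
      e]
    rw [real_inner_comm (u' t) (A (u t)), real_inner_comm (u' t) (F (u t)),
      real_inner_comm (u' t) (M _ _)]
    ring
  have hgrow := gronwall_memory hVc hVd hV0 ha hb hc hT (by
    intro N hN t ht hs
    set P := √(2 * N) + ρ with hP
    have hP0 : 0 ≤ P := by positivity
    have hhist := hsol.norm_le_history hφ hφρ hρ.le (Real.sqrt_nonneg (2 * N))
      fun s hst => hbound (hs s hst)
    have hseg {θ : ℝ} (hθ : θ ∈ Icc (-h) 0) : ‖u (t + θ)‖ ≤ P ∧ ‖u' (t + θ)‖ ≤ P :=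
      hhist _ ⟨by linarith [ht.1, hθ.1], by linarith [hθ.2]⟩
    have : Nonempty (Icc (-h) (0 : ℝ)) := ⟨⟨0, by simpa using hh.le⟩⟩
    have hWt : ‖W t‖ ≤ M₀ + M₁ * (√‖A‖ * P + P) := by
      refine (hM2 _ _ (IsC1Pair.segment hsol.1 hsol.2.1 ht.1)).trans ?_
      gcongr
      · exact ciSup_le fun θ => (sqrt_inner_self_le A _).trans (by gcongr; exact (hseg θ.2).1)
      · exact ciSup_le fun θ => (hseg θ.2).2
    obtain ⟨hut, hut'⟩ := hhist t ⟨by linarith [ht.1], le_rfl⟩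
    have hFt : ‖Fstar (u t)‖ ≤ L * P + ‖Fstar 0‖ := by
      have h₁ := hFstar_lip.norm_sub_le (u t) 0
      rw [sub_zero] at h₁
      have h₂ : (L : ℝ) * ‖u t‖ ≤ L * P := by gcongr
      linarith [norm_le_norm_add_norm_sub' (Fstar (u t)) (Fstar 0)]
    have i₁ : -⟪W t, u' t⟫ ≤ (M₀ + M₁ * (√‖A‖ * P + P)) * P :=
      (neg_le_abs _).trans ((abs_real_inner_le_norm _ _).trans (by gcongr))
    have i₂ : -⟪Fstar (u t), u' t⟫ ≤ (L * P + ‖Fstar 0‖) * P :=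
      (neg_le_abs _).trans ((abs_real_inner_le_norm _ _).trans (by gcongr))
    have i₃ : ⟪u t, u' t⟫ ≤ P * P := (real_inner_le_norm _ _).trans (by gcongr)
    have hPsq : P ^ 2 ≤ 4 * N + 2 * ρ ^ 2 := by
      have := Real.sq_sqrt (show 0 ≤ 2 * N by positivity)
      rw [hP]
      nlinarith [sq_nonneg (√(2 * N) - ρ)]
    calc V' t ≤ (M₀ + M₁ * (√‖A‖ * P + P)) * P + (L * P + ‖Fstar 0‖) * P + P * P := by
          simp only [hV']
          linarith [mul_nonneg hk.le (sq_nonneg ‖u' t‖)]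
      _ = K₀ * P + K₁ * P ^ 2 := by simp only [hK₀_def, hK₁_def]; ring
      _ ≤ K₀ * (P ^ 2 + 1) + K₁ * P ^ 2 := by gcongr; nlinarith [sq_nonneg (P - 1)]
      _ = (K₀ + K₁) * P ^ 2 + K₀ := by ring
      _ ≤ (K₀ + K₁) * (4 * N + 2 * ρ ^ 2) + K₀ := by gcongr
      _ = c + b * N := by simp only [hc_def, hb_def]; ring)
  refine hsol.norm_le_history hφ hφρ hρ.le (Real.sqrt_nonneg _) fun s hs => hbound ?_
  refine (hgrow s hs).trans ?_
  gcongr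
  exact hs.2

/-- Lipschitz continuous dependence of solutions on initial data. -/
theorem lipschitz_dependence_on_data
    (n : ℕ) (hn : 1 ≤ n) (h k : ℝ) (hh : 0 < h) (hk : 0 < k)
    (A : Euc n →L[ℝ] Euc n)
    (hA_symm : ∀ x y : Euc n, ⟪A x, y⟫ = ⟪x, A y⟫)
    (hA_pos : ∀ x : Euc n, x ≠ 0 → 0 < ⟪A x, x⟫)
    (F : Euc n → Euc n) (hF1 : LocallyLipschitz F)
    (M : (ℝ → Euc n) → (ℝ → Euc n) → Euc n)
    (hM1 : HypM1 n h M)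
    -- Hypothesis (F2)
    (Pot Pot0 Pot1 : Euc n → ℝ) (Fstar : Euc n → Euc n)
    (hPot_smooth : ContDiff ℝ 1 Pot)
    (hF_grad : ∀ x : Euc n, HasGradientAt Pot (F x - Fstar x) x)
    (L_Fstar : NNReal) (hFstar_lip : LipschitzWith L_Fstar Fstar)
    (hPot_split : ∀ x, Pot x = Pot0 x + Pot1 x)
    (hPot0_nonneg : ∀ x, 0 ≤ Pot0 x)
    (hPot1_bound : ∀ η > (0:ℝ), ∃ C > (0:ℝ), ∀ x : Euc n,
      |Pot1 x| ≤ η * (⟪A x, x⟫ + Pot0 x) + C)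
    -- Hypothesis (M2)
    (M₀ M₁ : ℝ) (hM₀ : 0 ≤ M₀) (hM₁ : 0 ≤ M₁)
    (hM2 : ∀ φ φ' : ℝ → Euc n, IsC1Pair n h φ φ' →
      ‖M φ φ'‖ ≤ M₀ + M₁ * ((⨆ θ : Icc (-h) (0:ℝ), Real.sqrt ⟪A (φ θ.1), φ θ.1⟫) +
        ⨆ θ : Icc (-h) (0:ℝ), ‖φ' θ.1‖))
    (ρ T : ℝ) (hρ : 0 < ρ) (hT : 0 < T) :
    ∃ C > (0:ℝ), ∀ φ₁ φ₁' φ₂ φ₂' u₁ u₁' u₂ u₂' : ℝ → Euc n,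
      IsC1Pair n h φ₁ φ₁' → IsC1Pair n h φ₂ φ₂' →
      Wnorm n h φ₁ φ₁' ≤ ρ → Wnorm n h φ₂ φ₂' ≤ ρ →
      IsGlobalMildSol n h k A F M φ₁ φ₁' u₁ u₁' →
      IsGlobalMildSol n h k A F M φ₂ φ₂' u₂ u₂' →
      ∀ t ∈ Icc (0:ℝ) T,
        Real.sqrt ⟪A (u₁ t - u₂ t), u₁ t - u₂ t⟫ + ‖u₁' t - u₂' t‖
          ≤ C * Wnorm n h (φ₁ - φ₂) (φ₁' - φ₂') := by
  obtain ⟨C₁, hC₁, hPot1⟩ := hPot1_bound (1 / 2) (by norm_num)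
  obtain ⟨R, hR, hbd⟩ := exists_apriori_bound hh hk hA_symm hF1.continuous hM1
    hPot_smooth.continuous hF_grad hFstar_lip hPot_split hPot0_nonneg hC₁ hPot1 hM₀ hM₁ hM2 hρ hT.le
  obtain ⟨K, hK⟩ := (locallyLipschitzOn_univ.2 hF1 |>.mono
    (subset_univ (Metric.closedBall (0 : Euc n) R))).exists_lipschitzOnWith_of_compact
    (isCompact_closedBall _ _)
  obtain ⟨C, hC, hMC⟩ := hM1 (R + R) (by positivity)
  set b : ℝ := 1 + k + ‖A‖ + K + 2 * C with hb_def
  refine ⟨(√‖A‖ + 1) * (2 * (1 + 2 * C * T) * exp (2 * b * T)), by positivity, ?_⟩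
  intro φ₁ φ₁' φ₂ φ₂' u₁ u₁' u₂ u₂' hφ₁ hφ₂ hρ₁ hρ₂ hs₁ hs₂
  set D := Wnorm n h (φ₁ - φ₂) (φ₁' - φ₂') with hD
  have hφ := hφ₁.sub hφ₂
  have hinit {θ : ℝ} (hθ : θ ∈ Icc (-h) 0) : ‖u₁ θ - u₂ θ‖ ≤ D ∧ ‖u₁' θ - u₂' θ‖ ≤ D := by
    rw [(hs₁.2.2.1 θ hθ).1, (hs₁.2.2.1 θ hθ).2, (hs₂.2.2.1 θ hθ).1, (hs₂.2.2.1 θ hθ).2]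
    exact hφ.norm_le_Wnorm hθ
  have h0 : (0 : ℝ) ∈ Icc (-h) 0 := by simpa using hh.le
  have hD0 : 0 ≤ D := (norm_nonneg _).trans (hinit h0).1
  have hsub : Icc 0 T ⊆ Ici (-h) := fun t ht => by simp only [mem_Ici]; linarith [ht.1]
  have hgrow := gronwall_memory_norm (y := fun t => (u₁ t - u₂ t, u₁' t - u₂' t)) (a := D) (b := b)
    (c := 2 * C * D) (T := T)
    (((hs₁.continuousOn.mono hsub).sub (hs₂.continuousOn.mono hsub)).prodMk
      ((hs₁.2.1.mono hsub).sub (hs₂.2.1.mono hsub)))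
    (fun t ht => ((hs₁.hasDerivWithinAt hh.le ht.1).sub
      (hs₂.hasDerivWithinAt hh.le ht.1)).prodMk
      ((hs₁.hasDerivWithinAt_deriv hh.le hF1.continuous hM1 ht.1).sub
        (hs₂.hasDerivWithinAt_deriv hh.le hF1.continuous hM1 ht.1)))
    (max_le (hinit h0).1 (hinit h0).2) (by positivity) (by positivity) hT.le (by
      intro N hN t ht hs
      have hpast : ∀ s ∈ Icc (-h) t, ‖u₁ s - u₂ s‖ ≤ N + D ∧ ‖u₁' s - u₂' s‖ ≤ N + D := by
        intro s hst
        rcases le_total 0 s with h0s | h0s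
        · have := max_le_iff.1 (hs s ⟨h0s, hst.2⟩)
          constructor <;> linarith [this.1, this.2]
        · have := hinit ⟨hst.1, h0s⟩
          constructor <;> linarith [this.1, this.2]
      obtain ⟨hw, hw'⟩ := max_le_iff.1 (hs t ⟨ht.1, le_rfl⟩)
      simp only at hw hw'
      have hmem {θ : ℝ} (hθ : θ ∈ Icc (-h) 0) : t + θ ∈ Icc (-h) t :=
        ⟨by linarith [ht.1, hθ.1], by linarith [hθ.2]⟩
      have hmem' {θ : ℝ} (hθ : θ ∈ Icc (-h) 0) : t + θ ∈ Icc (-h) T :=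
        ⟨(hmem hθ).1, (hmem hθ).2.trans ht.2.le⟩
      have hb₁ := hbd _ _ _ _ hφ₁ hρ₁ hs₁
      have hb₂ := hbd _ _ _ _ hφ₂ hρ₂ hs₂
      have hMd := (hMC _ _ _ _ (IsC1Pair.segment hs₁.1 hs₁.2.1 ht.1)
        (IsC1Pair.segment hs₂.1 hs₂.2.1 ht.1)
        (Wnorm_le hh.le (fun θ hθ => (hb₁ _ (hmem' hθ)).1) (fun θ hθ => (hb₁ _ (hmem' hθ)).2))
        (Wnorm_le hh.le (fun θ hθ => (hb₂ _ (hmem' hθ)).1)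
          (fun θ hθ => (hb₂ _ (hmem' hθ)).2))).trans (mul_le_mul_of_nonneg_left
        (Wnorm_le hh.le (fun θ hθ => (hpast _ (hmem hθ)).1) (fun θ hθ => (hpast _ (hmem hθ)).2))
        hC.le)
      have htT : t ∈ Icc (-h) T := ⟨by linarith [ht.1], ht.2.le⟩
      have hFd : ‖F (u₁ t) - F (u₂ t)‖ ≤ K * N :=
        (hK.norm_sub_le (by simpa using (hb₁ t htT).1) (by simpa using (hb₂ t htT).1)).trans
          (by gcongr)
      have hkd : ‖k • (u₁' t - u₂' t)‖ ≤ k * N := by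
        rw [norm_smul, Real.norm_of_nonneg hk.le]; gcongr
      have hAd : ‖A (u₁ t - u₂ t)‖ ≤ ‖A‖ * N := A.le_opNorm_of_le hw
      refine max_le ?_ ?_
      · simp only [hb_def]
        have : 0 ≤ (k + ‖A‖ + K + 2 * C) * N := by positivity
        have : 0 ≤ 2 * C * D := by positivity
        linarith
      · simp only
        rw [← norm_neg, show ∀ (a₁ b₁ c₁ d₁ a₂ b₂ c₂ d₂ : Euc n),
            -(-(a₁ + b₁ + c₁ + d₁) - -(a₂ + b₂ + c₂ + d₂)) =
              (a₁ - a₂) + (b₁ - b₂) + (c₁ - c₂) + (d₁ - d₂) by intros; abel,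
          ← smul_sub, ← map_sub]
        refine norm_add₄_le.trans ?_
        simp only [hb_def]
        linarith)
  intro t ht
  have hexp : exp (2 * b * t) ≤ exp (2 * b * T) := by gcongr; exact ht.2
  obtain ⟨hw, hw'⟩ := max_le_iff.1 ((hgrow t ht).trans
    (mul_le_mul_of_nonneg_left hexp (by positivity)))
  simp only at hw hw'
  calc _ ≤ √‖A‖ * (2 * (D + 2 * C * D * T) * exp (2 * b * T)) +
        2 * (D + 2 * C * D * T) * exp (2 * b * T) := by
        refine add_le_add ((sqrt_inner_self_le A _).trans ?_) hw'
        gcongr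
    _ = _ := by ring
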